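/- Let θ > 1 be a real number, set μ := 1 − (θ−1)/(θ log θ), and define f : (0,1) → ℝ by f(x) := (1/log θ)( (1−x) log θ/(θ−1) − 1 − log( (1−x) log θ/(θ−1) ) ). Then μ ∈ (0,1), f has a unique fixed point in (0,1), namely f(μ) = μ, and f(x) > x for every x ∈ (0,1) with x ≠ μ. -/

import Mathlib

open Filter Topology

/-- for `θ > 1` and `μ = 1 - (θ-1)/(θ log θ)`, the function
`f(x) = (1/log θ)((1-x) log θ/(θ-1) - 1 - log((1-x) log θ/(θ-1)))` on `(0,1)` satisfies:
`μ ∈ (0,1)`, `μ` is the unique fixed point of `f` in `(0,1)`, and `f(x) > x` for every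
`x ∈ (0,1)` with `x ≠ μ`. -/
theorem statement19 (θ : ℝ) (hθ : 1 < θ)
    (μ : ℝ) (hμ : μ = 1 - (θ - 1) / (θ * Real.log θ))
    (f : ℝ → ℝ)
    (hf : ∀ x ∈ Set.Ioo (0:ℝ) 1, f x = (1 / Real.log θ) *
      ((1 - x) * Real.log θ / (θ - 1) - 1 -
        Real.log ((1 - x) * Real.log θ / (θ - 1)))) :
    μ ∈ Set.Ioo (0:ℝ) 1 ∧ f μ = μ ∧
      (∀ x ∈ Set.Ioo (0:ℝ) 1, f x = x → x = μ) ∧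
      (∀ x ∈ Set.Ioo (0:ℝ) 1, x ≠ μ → x < f x) := by
  have hL : 0 < Real.log θ := Real.log_pos hθ
  have hθ0 : 0 < θ := one_pos.trans hθ
  have hθ1 : 0 < θ - 1 := sub_pos.2 hθ
  have hμmem : μ ∈ Set.Ioo (0:ℝ) 1 := by
    have h := Real.log_lt_sub_one_of_pos (inv_pos.2 hθ0) (inv_lt_one_of_one_lt₀ hθ).ne
    rw [Real.log_inv] at h
    have h' : θ - 1 < θ * Real.log θ := by
      have := mul_lt_mul_of_pos_left h hθ0
      rw [mul_sub, mul_inv_cancel₀ hθ0.ne'] at this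
      linarith
    have hlt : (θ - 1) / (θ * Real.log θ) < 1 := (div_lt_one (by positivity)).2 h'
    have hpos : 0 < (θ - 1) / (θ * Real.log θ) := by positivity
    constructor <;> linarith
  have key : ∀ x ∈ Set.Ioo (0:ℝ) 1, f x - x =
      (θ * ((1 - x) * Real.log θ / (θ - 1)) - 1 -
        Real.log (θ * ((1 - x) * Real.log θ / (θ - 1)))) / Real.log θ := by
    intro x hx
    have hx1 : 0 < 1 - x := sub_pos.2 hx.2
    have hy : 0 < (1 - x) * Real.log θ / (θ - 1) := by positivity
    rw [hf x hx, Real.log_mul hθ0.ne' hy.ne']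
    field_simp
    ring
  have hfμ : f μ = μ := by
    have h1 : θ * ((1 - μ) * Real.log θ / (θ - 1)) = 1 := by
      rw [hμ]
      field_simp
      ring
    have h := key μ hμmem
    rw [h1, Real.log_one, sub_self, sub_zero, zero_div] at h
    linarith
  have hlt : ∀ x ∈ Set.Ioo (0:ℝ) 1, x ≠ μ → x < f x := by
    intro x hx hne
    have hx1 : 0 < 1 - x := sub_pos.2 hx.2
    have hy : 0 < θ * ((1 - x) * Real.log θ / (θ - 1)) := by positivity
    have hy1 : θ * ((1 - x) * Real.log θ / (θ - 1)) ≠ 1 := by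
      intro h
      apply hne
      rw [hμ, eq_sub_iff_add_eq, ← eq_sub_iff_add_eq', div_eq_iff (by positivity)]
      rw [mul_div_assoc', div_eq_one_iff_eq hθ1.ne'] at h
      linarith
    rw [← sub_pos, key x hx]
    exact div_pos (by linarith [Real.log_lt_sub_one_of_pos hy hy1]) hL
  exact ⟨hμmem, hfμ, fun x hx h => by_contra fun hne => (hlt x hx hne).ne' h, hlt⟩
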